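/- Series representation of entropy: for every x ∈ M, H(x) = x(ℝ̄) − Σ_{k=1}^{∞} (1/(log 2 · 2k(2k−1))) · M_k(x), the series converging absolutely. -/

import Mathlib

open MeasureTheory Real Filter Topology Polynomial

noncomputable section

/-- The space of finite signed Borel measures on the extended reals `ℝ̄`. -/
abbrev SM := MeasureTheory.SignedMeasure EReal

namespace SCLDPC

/-- The weight `e^{-α/2}` as an extended nonnegative real (`+∞` at `α = -∞`). -/
def wt (α : EReal) : ENNReal :=
  if α = ⊥ then ⊤ else if α = ⊤ then 0 else ENNReal.ofReal (Real.exp (-(α.toReal) / 2))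

/-- A (nonnegative) Borel measure `μ` on `ℝ̄` is symmetric if
`∫_{-E} e^{-α/2} μ(dα) = ∫_{E} e^{-α/2} μ(dα)` for every Borel set `E`
(stated with extended nonnegative integrals, which is equivalent to requiring
equality whenever one of the two sides is finite). -/
def IsSymmMeasure (μ : Measure EReal) : Prop :=
  ∀ E : Set EReal, MeasurableSet E →
    ∫⁻ α in (fun a : EReal => -a) ⁻¹' E, wt α ∂μ = ∫⁻ α in E, wt α ∂μ

/-- Positive part of the Jordan decomposition. -/
def jp (x : SM) : Measure EReal := x.toJordanDecomposition.posPart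

/-- Negative part of the Jordan decomposition. -/
def jn (x : SM) : Measure EReal := x.toJordanDecomposition.negPart

instance (x : SM) : IsFiniteMeasure (jp x) := x.toJordanDecomposition.posPart_finite

instance (x : SM) : IsFiniteMeasure (jn x) := x.toJordanDecomposition.negPart_finite

/-- A finite signed Borel measure on `ℝ̄` is symmetric iff both parts of its Jordan
decomposition are symmetric measures. -/
def IsSymm (x : SM) : Prop := IsSymmMeasure (jp x) ∧ IsSymmMeasure (jn x)

/-- Membership in `X`, the set of symmetric probability measures on `ℝ̄`. -/
def MemX (x : SM) : Prop :=
  (∃ (μ : Measure EReal) (hμ : IsProbabilityMeasure μ),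
      x = (letI := hμ; μ.toSignedMeasure)) ∧ IsSymm x

/-- Membership in `X_d`, the set of differences of symmetric probability measures. -/
def MemXd (y : SM) : Prop := ∃ x1 x2 : SM, MemX x1 ∧ MemX x2 ∧ y = x1 - x2

/-- Integral of a real function against a finite signed measure. -/
def sInt (f : EReal → ℝ) (x : SM) : ℝ := (∫ α, f α ∂(jp x)) - ∫ α, f α ∂(jn x)

/-- `tanh(α/2)` extended continuously to `ℝ̄`. -/
def tanhHalf (α : EReal) : ℝ :=
  if α = ⊤ then 1 else if α = ⊥ then -1 else Real.tanh (α.toReal / 2)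

/-- The inverse hyperbolic tangent on `(-1, 1)`. -/
def artanh (t : ℝ) : ℝ := Real.log ((1 + t) / (1 - t)) / 2

/-- `2 tanh⁻¹(t)` valued in `ℝ̄` (sending `t ≥ 1` to `+∞` and `t ≤ -1` to `-∞`). -/
def atanhTwo (t : ℝ) : EReal :=
  if 1 ≤ t then ⊤ else if t ≤ -1 then ⊥ else ((2 * artanh t : ℝ) : EReal)

/-- Variable-node convolution `⊛` of two (nonnegative) measures:
`(μ ⊛ ν)(E) = ∫ μ(E - α) ν(dα)`, i.e. the pushforward of `μ × ν` under addition. -/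
def mConv (μ ν : Measure EReal) : Measure EReal :=
  (μ.prod ν).map fun p => p.1 + p.2

/-- Check-node convolution `⊠` of two (nonnegative) measures:
`(μ ⊠ ν)(E) = ∫ μ(2 tanh⁻¹(tanh(E/2) / tanh(α/2))) ν(dα)`, where the argument of `μ`
is the image of `E` under `β ↦ 2 tanh⁻¹(tanh(β/2) / tanh(α/2))`; equivalently, the
pushforward of `μ × ν` under `(β, α) ↦ 2 tanh⁻¹(tanh(β/2) · tanh(α/2))`. -/
def mCheck (μ ν : Measure EReal) : Measure EReal :=
  (μ.prod ν).map fun p => atanhTwo (tanhHalf p.1 * tanhHalf p.2)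

instance (μ ν : Measure EReal) [IsFiniteMeasure μ] [IsFiniteMeasure ν] :
    IsFiniteMeasure (mConv μ ν) := by unfold mConv; infer_instance

instance (μ ν : Measure EReal) [IsFiniteMeasure μ] [IsFiniteMeasure ν] :
    IsFiniteMeasure (mCheck μ ν) := by unfold mCheck; infer_instance

/-- The variable-node operation `⊛` extended bilinearly to finite signed measures. -/
def sConv (x y : SM) : SM :=
  (mConv (jp x) (jp y)).toSignedMeasure - (mConv (jp x) (jn y)).toSignedMeasure
    - (mConv (jn x) (jp y)).toSignedMeasure + (mConv (jn x) (jn y)).toSignedMeasure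

/-- The check-node operation `⊠` extended bilinearly to finite signed measures. -/
def sCheck (x y : SM) : SM :=
  (mCheck (jp x) (jp y)).toSignedMeasure - (mCheck (jp x) (jn y)).toSignedMeasure
    - (mCheck (jn x) (jp y)).toSignedMeasure + (mCheck (jn x) (jn y)).toSignedMeasure

/-- The integrand `log₂(1 + e^{-α})` of the entropy functional (with the harmless
convention that it vanishes at `α = ±∞`; symmetric measures put no mass at `-∞`). -/
def entFn (α : EReal) : ℝ :=
  if α = ⊤ then 0 else if α = ⊥ then 0 else Real.logb 2 (1 + Real.exp (-(α.toReal)))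

/-- The entropy functional `H(x) = ∫ log₂(1 + e^{-α}) x(dα)`. -/
def H (x : SM) : ℝ := sInt entFn x

/-- The tanh-moment functional `M_k(x) = ∫ tanh(α/2)^{2k} x(dα)`. -/
def Mfun (k : ℕ) (x : SM) : ℝ := sInt (fun α => tanhHalf α ^ (2 * k)) x

/-- The coefficient `(log 2)⁻¹ / (2k (2k - 1))` of the entropy series. -/
def serCoef (k : ℕ) : ℝ := (Real.log 2 * (2 * (k : ℝ)) * (2 * (k : ℝ) - 1))⁻¹

lemma tanhHalf_measurable : Measurable tanhHalf := by
  unfold tanhHalf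
  refine Measurable.ite (measurableSet_singleton _) measurable_const ?_
  refine Measurable.ite (measurableSet_singleton _) measurable_const ?_
  have h : Continuous Real.tanh := by
    have : Real.tanh = fun x => Real.sinh x / Real.cosh x := by
      funext x; exact Real.tanh_eq_sinh_div_cosh x
    rw [this]
    exact Real.continuous_sinh.div Real.continuous_cosh (fun x => (Real.cosh_pos x).ne')
  exact h.measurable.comp (measurable_ereal_toReal.div_const 2)

lemma entFn_measurable : Measurable entFn := by
  unfold entFn Real.logb
  refine Measurable.ite (measurableSet_singleton _) measurable_const ?_
  refine Measurable.ite (measurableSet_singleton _) measurable_const ?_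
  exact (Real.measurable_log.comp
    ((Real.measurable_exp.comp measurable_ereal_toReal.neg).const_add 1)).div_const _

lemma wt_measurable : Measurable wt := by
  unfold wt
  refine Measurable.ite (measurableSet_singleton _) measurable_const ?_
  refine Measurable.ite (measurableSet_singleton _) measurable_const ?_
  exact (Real.measurable_exp.comp (measurable_ereal_toReal.neg.div_const 2)).ennreal_ofReal

/-- Series identity on the open interval. -/
lemma series_open {t : ℝ} (ht : |t| < 1) :
    HasSum (fun k : ℕ => serCoef (k + 1) * t ^ (2 * (k + 1)))
      (1 - Real.binEntropy ((1 + t) / 2) / Real.log 2) := by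
  have h2 : Real.log 2 ≠ 0 := (Real.log_pos (by norm_num)).ne'
  have h1 := Real.hasSum_log_sub_log_of_abs_lt_one ht
  have hsq : |t ^ 2| < 1 := by
    rw [abs_pow]; exact pow_lt_one₀ (abs_nonneg t) ht two_ne_zero
  have h3 := Real.hasSum_pow_div_log_of_abs_lt_one hsq
  have h4 := ((h1.mul_left (t / 2)).sub (h3.mul_left (1 / 2))).mul_left (Real.log 2)⁻¹
  obtain ⟨ha, hb⟩ := abs_lt.mp ht
  have hp : (0 : ℝ) < 1 + t := by linarith
  have hm : (0 : ℝ) < 1 - t := by linarith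
  convert h4 using 1
  · rfl
  · funext k
    unfold serCoef
    have e1 : (2 * (k : ℝ) + 1) ≠ 0 := by positivity
    have e2 : ((k : ℝ) + 1) ≠ 0 := by positivity
    have e3 : (2 * ((k : ℝ) + 1) - 1) ≠ 0 := by
      have : 2 * ((k : ℝ) + 1) - 1 = 2 * k + 1 := by ring
      rw [this]; exact e1
    push_cast
    rw [show (2 * ((k : ℝ) + 1) - 1) = 2 * k + 1 by ring]
    rw [← pow_mul]
    field_simp
    ring
  · have e : 1 - t ^ 2 = (1 + t) * (1 - t) := by ring
    have e' : 1 - (1 + t) / 2 = (1 - t) / 2 := by ring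
    rw [e, Real.log_mul hp.ne' hm.ne', Real.binEntropy, e', Real.log_inv, Real.log_inv,
      Real.log_div hp.ne' two_ne_zero, Real.log_div hm.ne' two_ne_zero]
    field_simp
    ring

lemma serCoef_nonneg (k : ℕ) : 0 ≤ serCoef (k + 1) := by
  unfold serCoef
  push_cast
  rw [show (2 * ((k : ℝ) + 1) - 1) = 2 * k + 1 by ring]
  have := Real.log_pos (show (1 : ℝ) < 2 by norm_num)
  positivity

lemma serCoef_summable : Summable (fun k : ℕ => serCoef (k + 1)) := by
  have h : Summable (fun k : ℕ => (Real.log 2)⁻¹ * (1 / ((k + 1 : ℕ) : ℝ) ^ 2)) :=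
    ((summable_nat_add_iff 1).2
      (Real.summable_one_div_nat_pow.2 (by norm_num : 1 < 2))).mul_left _
  refine Summable.of_nonneg_of_le serCoef_nonneg (fun k => ?_) h
  have hl := Real.log_pos (show (1 : ℝ) < 2 by norm_num)
  unfold serCoef
  push_cast
  rw [one_div, ← mul_inv, mul_assoc]
  gcongr
  have : (0 : ℝ) ≤ k := by positivity
  nlinarith

lemma term_bound {t : ℝ} (ht : |t| ≤ 1) (k : ℕ) :
    ‖serCoef (k + 1) * t ^ (2 * (k + 1))‖ ≤ serCoef (k + 1) := by
  rw [norm_mul, Real.norm_of_nonneg (serCoef_nonneg k), norm_pow, Real.norm_eq_abs]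
  exact mul_le_of_le_one_right (serCoef_nonneg k) (pow_le_one₀ (abs_nonneg _) ht)

lemma series_closed {t : ℝ} (ht : |t| ≤ 1) :
    HasSum (fun k : ℕ => serCoef (k + 1) * t ^ (2 * (k + 1)))
      (1 - Real.binEntropy ((1 + t) / 2) / Real.log 2) := by
  have hs : Summable (fun k : ℕ => serCoef (k + 1) * t ^ (2 * (k + 1))) :=
    Summable.of_norm_bounded serCoef_summable (term_bound ht)
  have hc : ContinuousOn (fun s : ℝ => ∑' k : ℕ, serCoef (k + 1) * s ^ (2 * (k + 1)))
      (Set.Icc (-1) 1) := by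
    refine continuousOn_tsum (fun k => by fun_prop) serCoef_summable ?_
    intro k s hs
    exact term_bound (abs_le.2 hs) k
  have hc2 : ContinuousOn (fun s : ℝ => 1 - Real.binEntropy ((1 + s) / 2) / Real.log 2)
      (Set.Icc (-1) 1) := by
    have := Real.binEntropy_continuous
    apply Continuous.continuousOn
    fun_prop
  have heq : Set.EqOn (fun s : ℝ => ∑' k : ℕ, serCoef (k + 1) * s ^ (2 * (k + 1)))
      (fun s : ℝ => 1 - Real.binEntropy ((1 + s) / 2) / Real.log 2) (Set.Ioo (-1) 1) := by
    intro s hs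
    exact (series_open (abs_lt.2 hs)).tsum_eq
  have h := heq.of_subset_closure hc hc2 Set.Ioo_subset_Icc_self
    (by rw [closure_Ioo (by norm_num)])
  have heqt := h (abs_le.1 ht)
  have hsum := hs.hasSum
  simp only at heqt
  rwa [heqt] at hsum

lemma tanhHalf_coe (r : ℝ) : tanhHalf (r : EReal) = Real.tanh (r / 2) := by
  simp [tanhHalf]

lemma entFn_coe (r : ℝ) : entFn (r : EReal) = Real.logb 2 (1 + Real.exp (-r)) := by
  simp [entFn]

lemma one_add_tanh (r : ℝ) : (1 + Real.tanh (r / 2)) / 2 = (1 + Real.exp (-r))⁻¹ := by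
  rw [Real.tanh_eq_sinh_div_cosh, Real.sinh_eq, Real.cosh_eq]
  have e : Real.exp (-r) = Real.exp (-(r / 2)) * Real.exp (-(r / 2)) := by
    rw [← Real.exp_add]; congr 1; ring
  have e' : Real.exp (r / 2) * Real.exp (-(r / 2)) = 1 := by
    rw [← Real.exp_add]; simp
  rw [e]
  have p1 := Real.exp_pos (r / 2)
  have p2 := Real.exp_pos (-(r / 2))
  set a := Real.exp (r / 2)
  set b := Real.exp (-(r / 2))
  have : a = b⁻¹ := eq_inv_of_mul_eq_one_left e'
  rw [this]
  field_simp
  ring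

lemma abs_tanh_lt (r : ℝ) : |Real.tanh (r / 2)| < 1 := by
  have h1 := one_add_tanh r
  have h2 := one_add_tanh (-r)
  rw [neg_div, Real.tanh_neg] at h2
  have p1 : 0 < (1 + Real.exp (-r))⁻¹ := by positivity
  have p2 : 0 < (1 + Real.exp (-(-r)))⁻¹ := by positivity
  rw [abs_lt]; constructor <;> linarith

lemma abs_tanhHalf_le (α : EReal) : |tanhHalf α| ≤ 1 := by
  induction α using EReal.rec with
  | bot => simp [tanhHalf]
  | coe r => rw [tanhHalf_coe]; exact (abs_tanh_lt r).le
  | top => simp [tanhHalf]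

lemma tanhHalf_neg (α : EReal) : tanhHalf (-α) = - tanhHalf α := by
  induction α using EReal.rec with
  | bot => simp [tanhHalf]
  | coe r => rw [← EReal.coe_neg, tanhHalf_coe, tanhHalf_coe, neg_div, Real.tanh_neg]
  | top => simp [tanhHalf]

lemma entFn_nonneg (α : EReal) : 0 ≤ entFn α := by
  induction α using EReal.rec with
  | bot => simp [entFn]
  | coe r =>
    rw [entFn_coe]
    exact Real.logb_nonneg (by norm_num) (by have := Real.exp_pos (-r); linarith)
  | top => simp [entFn]

/-- Symmetrized entropy integrand. -/
lemma ent_symm (α : EReal) :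
    entFn α * ((1 + tanhHalf α) / 2) + entFn (-α) * ((1 - tanhHalf α) / 2)
      = Real.binEntropy ((1 + tanhHalf α) / 2) / Real.log 2 := by
  induction α using EReal.rec with
  | bot => simp [entFn, tanhHalf]
  | coe r =>
    have h1 := one_add_tanh r
    have h2 := one_add_tanh (-r)
    rw [neg_div, Real.tanh_neg] at h2
    have h3 : 1 - (1 + Real.tanh (r / 2)) / 2 = (1 + -Real.tanh (r / 2)) / 2 := by ring
    rw [← EReal.coe_neg, tanhHalf_coe, entFn_coe, entFn_coe, Real.binEntropy, h3, sub_eq_add_neg,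
      h1, h2, inv_inv, inv_inv, Real.logb, Real.logb]
    ring
  | top => simp [entFn, tanhHalf]

/-- The even factor `sech (α/2)`. -/
def sech (α : EReal) : ENNReal :=
  if α = ⊥ then 0 else if α = ⊤ then 0 else ENNReal.ofReal (Real.cosh (α.toReal / 2))⁻¹

lemma sech_measurable : Measurable sech := by
  unfold sech
  refine Measurable.ite (measurableSet_singleton _) measurable_const ?_
  refine Measurable.ite (measurableSet_singleton _) measurable_const ?_
  exact (Real.continuous_cosh.measurable.comp
    (measurable_ereal_toReal.div_const 2)).inv.ennreal_ofReal

lemma sech_neg (α : EReal) : sech (-α) = sech α := by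
  induction α using EReal.rec with
  | bot => simp [sech]
  | coe r => rw [← EReal.coe_neg]; simp [sech, neg_div]
  | top => simp [sech]

lemma wt_mul_sech {α : EReal} (h : α ≠ ⊥) : wt α * sech α = ENNReal.ofReal (1 - tanhHalf α) := by
  induction α using EReal.rec with
  | bot => exact absurd rfl h
  | coe r =>
    rw [tanhHalf_coe]
    simp only [wt, sech, EReal.coe_ne_bot, EReal.coe_ne_top, if_false, EReal.toReal_coe]
    rw [← ENNReal.ofReal_mul (Real.exp_pos _).le]
    congr 1
    have hc := (Real.cosh_pos (r / 2)).ne'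
    rw [Real.tanh_eq_sinh_div_cosh, neg_div, ← Real.cosh_sub_sinh]
    field_simp
  | top => simp [wt, sech, tanhHalf]

lemma measure_bot {μ : Measure EReal} [IsFiniteMeasure μ] (h : IsSymmMeasure μ) :
    μ {⊥} = 0 := by
  have := h {⊥} (measurableSet_singleton _)
  have e : (fun a : EReal => -a) ⁻¹' {⊥} = {⊤} := by
    ext a; simp
  rw [e] at this
  simp [wt] at this
  by_contra h0
  exact h0 this

lemma lint_symm {μ : Measure EReal} [IsFiniteMeasure μ] (h : IsSymmMeasure μ)
    {F : EReal → ENNReal} (hF : Measurable F) :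
    ∫⁻ α, F α * ENNReal.ofReal (1 - tanhHalf α) ∂μ
      = ∫⁻ α, F (-α) * ENNReal.ofReal (1 - tanhHalf α) ∂μ := by
  have hneg : Measurable (fun a : EReal => -a) := continuous_neg.measurable
  have hbot : ∀ᵐ α ∂μ, α ≠ ⊥ := by
    rw [ae_iff]; simpa using measure_bot h
  have hmap : (μ.withDensity wt).map (fun a : EReal => -a) = μ.withDensity wt := by
    ext E hE
    rw [Measure.map_apply hneg hE, withDensity_apply _ (hneg hE), withDensity_apply _ hE, h E hE]
  have key : ∀ G : EReal → ENNReal, Measurable G →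
      ∫⁻ α, G α * ENNReal.ofReal (1 - tanhHalf α) ∂μ
        = ∫⁻ α, G α * sech α ∂(μ.withDensity wt) := by
    intro G hG
    have e := lintegral_withDensity_eq_lintegral_mul μ wt_measurable (hG.mul sech_measurable)
    simp only [Pi.mul_apply] at e
    rw [e]
    refine lintegral_congr_ae ?_
    filter_upwards [hbot] with α hα
    rw [← wt_mul_sech hα]
    ring
  rw [key F hF, key (fun α => F (-α)) (hF.comp hneg)]
  conv_lhs => rw [← hmap]
  have e := lintegral_map (μ := μ.withDensity wt) (hF.mul sech_measurable) hneg
  simp only [Pi.mul_apply, sech_neg] at e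
  exact e

lemma ent_integral {μ : Measure EReal} [IsFiniteMeasure μ] (h : IsSymmMeasure μ) :
    ∫ α, entFn α ∂μ = ∫ α, Real.binEntropy ((1 + tanhHalf α) / 2) / Real.log 2 ∂μ := by
  have hneg : Measurable (fun a : EReal => -a) := continuous_neg.measurable
  have hb : ∀ α, -1 ≤ tanhHalf α ∧ tanhHalf α ≤ 1 := fun α => abs_le.1 (abs_tanhHalf_le α)
  have hg0 : ∀ α, 0 ≤ Real.binEntropy ((1 + tanhHalf α) / 2) / Real.log 2 := by
    intro α
    rw [← ent_symm]
    obtain ⟨h1, h2⟩ := hb α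
    have := entFn_nonneg α
    have := entFn_nonneg (-α)
    have : 0 ≤ (1 + tanhHalf α) / 2 := by linarith
    have : 0 ≤ (1 - tanhHalf α) / 2 := by linarith
    positivity
  have hgm : Measurable (fun α => Real.binEntropy ((1 + tanhHalf α) / 2) / Real.log 2) :=
    (Real.binEntropy_continuous.measurable.comp
      ((tanhHalf_measurable.const_add 1).div_const 2)).div_const _
  rw [integral_eq_lintegral_of_nonneg_ae (ae_of_all _ entFn_nonneg)
      entFn_measurable.aestronglyMeasurable,
    integral_eq_lintegral_of_nonneg_ae (ae_of_all _ hg0) hgm.aestronglyMeasurable]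
  congr 1
  have hF : Measurable (fun α => ENNReal.ofReal (entFn α / 2)) :=
    (entFn_measurable.div_const 2).ennreal_ofReal
  have hS := lint_symm h hF
  have hpm : Measurable (fun α => ENNReal.ofReal (entFn α / 2) *
      ENNReal.ofReal (1 + tanhHalf α)) :=
    hF.mul (tanhHalf_measurable.const_add 1).ennreal_ofReal
  have e1 : ∀ α, ENNReal.ofReal (entFn α) =
      ENNReal.ofReal (entFn α / 2) * ENNReal.ofReal (1 + tanhHalf α) +
      ENNReal.ofReal (entFn α / 2) * ENNReal.ofReal (1 - tanhHalf α) := by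
    intro α
    obtain ⟨h1, h2⟩ := hb α
    have h3 : 0 ≤ entFn α / 2 := by have := entFn_nonneg α; positivity
    rw [← ENNReal.ofReal_mul h3, ← ENNReal.ofReal_mul h3, ← ENNReal.ofReal_add
      (mul_nonneg h3 (by linarith)) (mul_nonneg h3 (by linarith))]
    congr 1; ring
  have e2 : ∀ α, ENNReal.ofReal (Real.binEntropy ((1 + tanhHalf α) / 2) / Real.log 2) =
      ENNReal.ofReal (entFn α / 2) * ENNReal.ofReal (1 + tanhHalf α) +
      ENNReal.ofReal (entFn (-α) / 2) * ENNReal.ofReal (1 - tanhHalf α) := by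
    intro α
    obtain ⟨h1, h2⟩ := hb α
    have h3 : 0 ≤ entFn α / 2 := by have := entFn_nonneg α; positivity
    have h4 : 0 ≤ entFn (-α) / 2 := by have := entFn_nonneg (-α); positivity
    rw [← ent_symm, ← ENNReal.ofReal_mul h3, ← ENNReal.ofReal_mul h4, ← ENNReal.ofReal_add
      (mul_nonneg h3 (by linarith)) (mul_nonneg h4 (by linarith))]
    congr 1; ring
  simp only [e1, e2]
  rw [lintegral_add_left hpm, lintegral_add_left hpm, hS]

lemma hasSum_measure {μ : Measure EReal} [IsFiniteMeasure μ] (h : IsSymmMeasure μ) :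
    HasSum (fun k : ℕ => serCoef (k + 1) * ∫ α, tanhHalf α ^ (2 * (k + 1)) ∂μ)
      (μ.real Set.univ - ∫ α, entFn α ∂μ) := by
  have hgm : Measurable (fun α => Real.binEntropy ((1 + tanhHalf α) / 2) / Real.log 2) :=
    (Real.binEntropy_continuous.measurable.comp
      ((tanhHalf_measurable.const_add 1).div_const 2)).div_const _
  have hgi : Integrable (fun α => Real.binEntropy ((1 + tanhHalf α) / 2) / Real.log 2) μ := by
    refine Integrable.of_bound hgm.aestronglyMeasurable (1 + ∑' k, serCoef (k + 1))
      (ae_of_all _ fun α => ?_)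
    have hs := series_closed (abs_tanhHalf_le α)
    have hn : ‖∑' k : ℕ, serCoef (k + 1) * tanhHalf α ^ (2 * (k + 1))‖
        ≤ ∑' k, serCoef (k + 1) :=
      tsum_of_norm_bounded serCoef_summable.hasSum (term_bound (abs_tanhHalf_le α))
    rw [hs.tsum_eq] at hn
    rw [Real.norm_eq_abs] at *
    rw [abs_le] at *
    constructor <;> linarith [hn.1, hn.2]
  have hI : ∫ α, (1 - Real.binEntropy ((1 + tanhHalf α) / 2) / Real.log 2) ∂μ
      = μ.real Set.univ - ∫ α, entFn α ∂μ := by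
    rw [integral_sub (integrable_const _) hgi, ent_integral h]
    simp
  rw [← hI]
  simp only [← integral_const_mul]
  refine hasSum_integral_of_dominated_convergence (fun k _ => serCoef (k + 1)) ?_ ?_ ?_ ?_ ?_
  · intro k
    exact ((tanhHalf_measurable.pow_const _).const_mul _).aestronglyMeasurable
  · intro k
    exact ae_of_all _ fun α => term_bound (abs_tanhHalf_le α) k
  · exact ae_of_all _ fun α => serCoef_summable
  · exact integrable_const _
  · exact ae_of_all _ fun α => series_closed (abs_tanhHalf_le α)

/-- Series representation of the entropy: for every finite signed
symmetric Borel measure `x`,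
`H(x) = x(ℝ̄) - Σ_{k ≥ 1} (log 2)⁻¹/(2k(2k-1)) · M_k(x)`,
the series converging absolutely. -/
theorem entropy_series (x : SM) (hx : IsSymm x) :
    (Summable fun k : ℕ => |serCoef (k + 1) * Mfun (k + 1) x|) ∧
    HasSum (fun k : ℕ => serCoef (k + 1) * Mfun (k + 1) x) (x Set.univ - H x) := by
  have hm : x Set.univ = (jp x).real Set.univ - (jn x).real Set.univ := by
    conv_lhs => rw [← x.toSignedMeasure_toJordanDecomposition]
    unfold JordanDecomposition.toSignedMeasure jp jn
    simp [Measure.toSignedMeasure_apply_measurable MeasurableSet.univ]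
  have hs : HasSum (fun k : ℕ => serCoef (k + 1) * Mfun (k + 1) x) (x Set.univ - H x) := by
    have h := (hasSum_measure hx.1).sub (hasSum_measure hx.2)
    convert h using 1
    · rfl
    · funext k
      unfold Mfun sInt
      ring
    · rw [hm]
      unfold H sInt
      ring
  exact ⟨hs.summable.abs, hs⟩

end SCLDPC
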